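/- arXiv:2201.02829 — 8 statements merged into one kernel-verified Lean document; each statement's English description precedes it below -/
import Mathlib

section
/- Let a > 0, λ ≥ 0 and L > 0 be real numbers with λ + a + L ≤ 2π, and define h_λ : [0, L] → ℝ by h_λ(θ) = 2[sin(a/2) + sin((λ + a + θ)/2) − sin(λ/2) − sin(θ/2)]. Then h_λ is strictly decreasing on [0, L]; consequently, if h_λ(L) > 0, then h_λ(θ) > 0 for every θ ∈ [0, L]. -/
open Real Set

/-- Let `a > 0`, `λ ≥ 0`, `L > 0` with `λ + a + L ≤ 2π`, and let
`h_λ(θ) = 2[sin(a/2) + sin((λ + a + θ)/2) − sin(λ/2) − sin(θ/2)]` on `[0, L]`.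
Then `h_λ` is strictly decreasing on `[0, L]`; consequently, if `h_λ(L) > 0`,
then `h_λ(θ) > 0` for every `θ ∈ [0, L]`. -/
theorem stmt_3 (a lam L : ℝ) (ha : 0 < a) (hlam : 0 ≤ lam) (hL : 0 < L)
    (hsum : lam + a + L ≤ 2 * π) (h : ℝ → ℝ)
    (hdef : ∀ θ : ℝ,
      h θ = 2 * (sin (a / 2) + sin ((lam + a + θ) / 2) - sin (lam / 2) - sin (θ / 2))) :
    StrictAntiOn h (Icc 0 L) ∧ (0 < h L → ∀ θ ∈ Icc 0 L, 0 < h θ) := by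
  have key : StrictAntiOn h (Icc 0 L) := by
    intro x hx y hy hxy
    obtain ⟨hx0, hxL⟩ := hx
    obtain ⟨hy0, hyL⟩ := hy
    have hs : 0 < sin ((lam + a) / 4) :=
      sin_pos_of_pos_of_lt_pi (by linarith) (by linarith [pi_pos])
    have hc : cos ((lam + a + 2 * y) / 4) < cos ((lam + a + 2 * x) / 4) :=
      cos_lt_cos_of_nonneg_of_le_pi (by linarith) (by linarith) (by linarith)
    have e : ∀ t : ℝ, sin ((lam + a + t) / 2) - sin (t / 2)
        = 2 * sin ((lam + a) / 4) * cos ((lam + a + 2 * t) / 4) := by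
      intro t
      rw [sin_sub_sin]
      congr 2
      · congr 1
        ring_nf
      · ring_nf
    have ex := e x
    have ey := e y
    have hm := mul_lt_mul_of_pos_left hc hs
    rw [hdef, hdef]
    linarith
  refine ⟨key, fun hp θ hθ => ?_⟩
  exact lt_of_lt_of_le hp (key.antitoneOn hθ ⟨hL.le, le_refl L⟩ hθ.2)
end

section
/- Let k ≥ 6 be an integer and let c, b, d be real numbers with 0 ≤ c ≤ 3/8, 2^{-(k+1)} ≤ b ≤ 5/8, and 0 ≤ d ≤ 2·4^{-k}. Then 2 sin(c) + d < 2 sin(c + b/2). -/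
open Real

/-- Let `k ≥ 6` be an integer and `c, b, d` reals with `0 ≤ c ≤ 3/8`,
`2^{-(k+1)} ≤ b ≤ 5/8`, and `0 ≤ d ≤ 2·4^{-k}`.  Then `2 sin c + d < 2 sin (c + b/2)`. -/
theorem stmt_5 (k : ℕ) (hk : 6 ≤ k) (c b d : ℝ)
    (hc0 : 0 ≤ c) (hc1 : c ≤ 3 / 8)
    (hb0 : 1 / 2 ^ (k + 1) ≤ b) (hb1 : b ≤ 5 / 8)
    (hd0 : 0 ≤ d) (hd1 : d ≤ 2 / 4 ^ k) :
    2 * sin c + d < 2 * sin (c + b / 2) := by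
  have hu0 : (0:ℝ) < 1 / 2 ^ k := by positivity
  have hu1 : (1:ℝ) / 2 ^ k ≤ 1 / 64 := by
    have h : (2:ℝ) ^ 6 ≤ 2 ^ k := pow_le_pow_right₀ (by norm_num) hk
    apply one_div_le_one_div_of_le (by norm_num)
    linarith
  have e1 : (1:ℝ) / 2 ^ (k + 1) = (1 / 2 ^ k) / 2 := by
    rw [pow_succ]; field_simp
  have e2 : (2:ℝ) / 4 ^ k = 2 * (1 / 2 ^ k) * (1 / 2 ^ k) := by
    rw [show (4:ℝ) = 2 * 2 by norm_num, mul_pow]; field_simp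
  rw [e1] at hb0
  rw [e2] at hd1
  generalize (1:ℝ) / 2 ^ k = u at *
  have hd : d ≤ u / 32 := by nlinarith
  obtain ⟨t, rfl⟩ : ∃ t, b = 4 * t := ⟨b / 4, by ring⟩
  have ht0 : 0 < t := by linarith
  have ht1 : t ≤ 5 / 32 := by linarith
  have hs := sin_gt_sub_cube ht0
  have hs' : t / 2 ≤ sin t := by nlinarith [mul_nonneg ht0.le ht0.le, mul_nonneg ht0.le (sub_nonneg.2 ht1), mul_nonneg (mul_nonneg ht0.le ht0.le) (sub_nonneg.2 ht1)]
  have hc := one_sub_sq_div_two_le_cos (x := c + t)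
  have hc' : 1 / 2 ≤ cos (c + t) := by nlinarith
  have h1 : sin (c + 4 * t / 2) = sin (c + t) * cos t + cos (c + t) * sin t := by
    rw [← sin_add]; ring_nf
  have h2 : sin c = sin (c + t) * cos t - cos (c + t) * sin t := by
    rw [← sin_sub]; ring_nf
  have h3 : 1 / 2 * (t / 2) ≤ cos (c + t) * sin t :=
    mul_le_mul hc' hs' (by positivity) (by linarith)
  rw [h1, h2]
  linarith
end

section
/- Let (X,d) be a metric space equipped with a Borel measure μ, let Ω ⊆ X be a μ-measurable set, and let x ∈ X be a point such that μ(B(x,r) ∩ Ω) > 0 for all sufficiently small r > 0. Suppose u : Ω → ℝ is μ-measurable, μ-integrable on B(x,r) ∩ Ω for small r > 0, and has trace Tu(x) = a at x. Then for every t ∈ ℝ with t ≠ a, the characteristic function χ_{{u>t}} of the superlevel set {y ∈ Ω : u(y) > t} has trace at x equal to 1 if a > t and equal to 0 if a < t. -/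
open MeasureTheory Metric Set Filter

/-- A function `u` (defined on `Ω`) has trace `a` at the point `x` if
`(1/μ(B(x,r)∩Ω)) ∫_{B(x,r)∩Ω} |u − a| dμ → 0` as `r → 0⁺`. -/
def HasTraceAt {X : Type*} [MetricSpace X] [MeasurableSpace X]
    (μ : Measure X) (Ω : Set X) (u : X → ℝ) (x : X) (a : ℝ) : Prop :=
  Tendsto (fun r : ℝ =>
      (∫ y in ball x r ∩ Ω, |u y - a| ∂μ) / (μ (ball x r ∩ Ω)).toReal)
    (nhdsWithin 0 (Ioi 0)) (nhds 0)

theorem trace_aux {X : Type*} [MetricSpace X] [MeasurableSpace X] [BorelSpace X]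
    (μ : Measure X) (Ω : Set X) (hΩ : MeasurableSet Ω) (x : X) (u v : X → ℝ)
    (hui : ∃ r₀ > 0, ∀ r : ℝ, 0 < r → r < r₀ → IntegrableOn u (ball x r ∩ Ω) μ)
    (a b c : ℝ) (hu : HasTraceAt μ Ω u x a)
    (h : ∀ y ∈ Ω, |v y - b| ≤ c * |u y - a|) : HasTraceAt μ Ω v x b := by
  obtain ⟨r₀, hr₀, hi⟩ := hui
  unfold HasTraceAt at *
  have hu2 := hu.const_mul c
  rw [mul_zero] at hu2
  refine squeeze_zero' (Eventually.of_forall fun r => ?_) ?_ hu2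
  · exact div_nonneg (integral_nonneg fun y => abs_nonneg _) ENNReal.toReal_nonneg
  · filter_upwards [Ioo_mem_nhdsGT hr₀] with r hr
    by_cases hfin : μ (ball x r ∩ Ω) = ⊤
    · simp [hfin]
    rw [← mul_div_assoc]
    refine div_le_div_of_nonneg_right ?_ ENNReal.toReal_nonneg
    rw [← integral_const_mul]
    have hc : IntegrableOn (fun _ : X => a) (ball x r ∩ Ω) μ :=
      integrableOn_const hfin
    refine integral_mono_of_nonneg (Eventually.of_forall fun y => abs_nonneg _)
      (((hi r hr.1 hr.2).sub hc).abs.const_mul c) ?_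
    filter_upwards [ae_restrict_mem (measurableSet_ball.inter hΩ)] with y hy
    exact h y hy.2

/-- If `u` is measurable, locally integrable near `x`, and has trace `a`
at `x`, then for every `t ≠ a`, the characteristic function of the superlevel set
`{y ∈ Ω : u y > t}` has trace `1` at `x` if `a > t`, and trace `0` at `x` if `a < t`. -/
theorem stmt_9 {X : Type*} [MetricSpace X] [MeasurableSpace X] [BorelSpace X]
    (μ : Measure X) (Ω : Set X) (hΩ : MeasurableSet Ω) (x : X)
    (hpos : ∃ r₀ > 0, ∀ r : ℝ, 0 < r → r < r₀ → 0 < μ (ball x r ∩ Ω))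
    (u : X → ℝ) (hum : Measurable u)
    (hui : ∃ r₀ > 0, ∀ r : ℝ, 0 < r → r < r₀ → IntegrableOn u (ball x r ∩ Ω) μ)
    (a : ℝ) (hu : HasTraceAt μ Ω u x a) :
    ∀ t : ℝ, t ≠ a →
      ((t < a → HasTraceAt μ Ω (indicator {y | y ∈ Ω ∧ t < u y} 1) x 1) ∧
        (a < t → HasTraceAt μ Ω (indicator {y | y ∈ Ω ∧ t < u y} 1) x 0)) := by
  intro t _
  refine ⟨fun hta => ?_, fun hat => ?_⟩
  · refine trace_aux μ Ω hΩ x u _ hui a 1 (1 / (a - t)) hu fun y hy => ?_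
    have hd : 0 < a - t := sub_pos.2 hta
    by_cases hty : t < u y
    · rw [indicator_of_mem (show y ∈ {y | y ∈ Ω ∧ t < u y} from ⟨hy, hty⟩)]
      simp only [Pi.one_apply, sub_self, abs_zero]
      positivity
    · rw [indicator_of_notMem (show y ∉ {y | y ∈ Ω ∧ t < u y} from fun hh => hty hh.2)]
      rw [one_div_mul_eq_div, le_div_iff₀ hd]
      have := neg_abs_le (u y - a)
      norm_num
      linarith
  · refine trace_aux μ Ω hΩ x u _ hui a 0 (1 / (t - a)) hu fun y hy => ?_
    have hd : 0 < t - a := sub_pos.2 hat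
    by_cases hty : t < u y
    · rw [indicator_of_mem (show y ∈ {y | y ∈ Ω ∧ t < u y} from ⟨hy, hty⟩)]
      rw [one_div_mul_eq_div, le_div_iff₀ hd]
      have := le_abs_self (u y - a)
      norm_num
      linarith
    · rw [indicator_of_notMem (show y ∉ {y | y ∈ Ω ∧ t < u y} from fun hh => hty hh.2)]
      simp only [sub_self, abs_zero]
      positivity
end

section
/- Let (X,d) be a metric space equipped with a Borel measure μ, let Ω ⊆ X be a bounded open set such that μ(B(x,r) ∩ Ω) > 0 for every x ∈ ∂Ω and every sufficiently small r > 0, and let ν be a finite Borel measure on ∂Ω. Suppose u : Ω → ℝ is μ-measurable and μ-integrable on B(x,r) ∩ Ω for small r > 0, f : ∂Ω → ℝ is ν-measurable, and for ν-a.e. x ∈ ∂Ω, u has trace Tu(x) = f(x) at x. Then for Lebesgue-a.e. t ∈ ℝ, the characteristic function χ_{{u>t}} of the superlevel set {y ∈ Ω : u(y) > t} has trace at x equal to χ_{{f>t}}(x) for ν-a.e. x ∈ ∂Ω. -/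
open MeasureTheory Metric Set Filter

/-- Let `Ω` be a bounded open set, `ν` a finite Borel measure on `∂Ω`,
and suppose `u` has trace `f(x)` at `ν`-a.e. `x ∈ ∂Ω`.  Then for Lebesgue-a.e. `t ∈ ℝ`,
the characteristic function of the superlevel set `{y ∈ Ω : u y > t}` has trace
`χ_{{f>t}}(x)` at `ν`-a.e. `x ∈ ∂Ω`. -/
theorem stmt_10 {X : Type*} [MetricSpace X] [MeasurableSpace X] [BorelSpace X]
    (μ ν : Measure X) [IsFiniteMeasure ν] (Ω : Set X)
    (hΩo : IsOpen Ω) (hΩb : Bornology.IsBounded Ω)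
    (hνsupp : ν (frontier Ω)ᶜ = 0)
    (hpos : ∀ x ∈ frontier Ω, ∃ r₀ > 0, ∀ r : ℝ, 0 < r → r < r₀ →
      0 < μ (ball x r ∩ Ω))
    (u : X → ℝ) (hum : Measurable u)
    (hui : ∀ x ∈ frontier Ω, ∃ r₀ > 0, ∀ r : ℝ, 0 < r → r < r₀ →
      IntegrableOn u (ball x r ∩ Ω) μ)
    (f : X → ℝ) (hfm : Measurable f)
    (htr : ∀ᵐ x ∂ν, x ∈ frontier Ω → HasTraceAt μ Ω u x (f x)) :
    ∀ᵐ t : ℝ, ∀ᵐ x ∂ν, x ∈ frontier Ω →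
      HasTraceAt μ Ω (indicator {y | y ∈ Ω ∧ t < u y} 1) x
        (if t < f x then 1 else 0) := by
  have hc : Set.Countable {t : ℝ | 0 < ν {x | f x = t}} :=
    Measure.countable_meas_level_set_pos hfm
  have hae : ∀ᵐ t : ℝ, ¬ (0 < ν {x | f x = t}) := by
    rw [ae_iff]
    simpa only [not_not] using hc.measure_zero volume
  filter_upwards [hae] with t ht
  have ht0 : ∀ᵐ x ∂ν, f x ≠ t := by
    rw [ae_iff]
    simpa only [ne_eq, not_not] using nonpos_iff_eq_zero.mp (not_lt.mp ht)
  filter_upwards [ht0, htr] with x hxt hx hxΩ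
  have hT := hx hxΩ
  obtain ⟨r₀, hr₀, hint⟩ := hui x hxΩ
  have hd : 0 < |f x - t| := abs_pos.mpr (sub_ne_zero.mpr hxt)
  unfold HasTraceAt at hT ⊢
  have hT' := hT.const_mul (|f x - t|⁻¹)
  rw [mul_zero] at hT'
  refine tendsto_of_tendsto_of_tendsto_of_le_of_le' tendsto_const_nhds hT' ?_ ?_
  · exact Eventually.of_forall fun r =>
      div_nonneg (integral_nonneg fun y => abs_nonneg _) ENNReal.toReal_nonneg
  · filter_upwards [Ioo_mem_nhdsGT hr₀] with r hr
    by_cases htop : μ (ball x r ∩ Ω) = ⊤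
    · simp [htop]
    rw [← mul_div_assoc]
    refine div_le_div_of_nonneg_right ?_ ENNReal.toReal_nonneg
    rw [← integral_const_mul]
    have hms : MeasurableSet (ball x r ∩ Ω) := measurableSet_ball.inter hΩo.measurableSet
    have hi : IntegrableOn (fun y => |f x - t|⁻¹ * |u y - f x|) (ball x r ∩ Ω) μ :=
      (((hint r hr.1 hr.2).sub (integrableOn_const htop)).abs).const_mul _
    refine integral_mono_of_nonneg (Eventually.of_forall fun y => abs_nonneg _) hi ?_
    filter_upwards [ae_restrict_mem hms] with y hy
    rw [inv_mul_eq_div, le_div_iff₀ hd]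
    have hyΩ : y ∈ Ω := hy.2
    by_cases h1 : t < u y <;> by_cases h2 : t < f x
    · simp [indicator, hyΩ, h1, h2]
    · have h3 : f x < t := lt_of_le_of_ne (not_lt.mp h2) hxt
      simp only [indicator, mem_setOf_eq, hyΩ, h1, h2, and_self, if_true, if_false, Pi.one_apply]
      rw [abs_of_neg (by linarith : f x - t < 0), abs_of_pos (by linarith : 0 < u y - f x)]
      norm_num
      linarith
    · simp only [indicator, mem_setOf_eq, hyΩ, h1, h2, and_false, if_true, if_false]
      rw [abs_of_pos (by linarith : 0 < f x - t), abs_of_neg (by linarith : u y - f x < 0)]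
      norm_num
      linarith
    · simp [indicator, h1, h2]
end

section
/- Let (X,d) be a metric space equipped with a Borel measure μ, let Ω ⊆ X be a μ-measurable set, and let x ∈ X be a point such that μ(B(x,r) ∩ Ω) > 0 for all sufficiently small r > 0. Let E₁, E₂ ⊆ Ω be μ-measurable sets and let c₁, c₂ ∈ {0,1} with not both c₁ = 1 and c₂ = 1. If χ_{E₁} has trace c₁ at x and χ_{E₂} has trace c₂ at x, then χ_{E₁ \ E₂} has trace c₁ at x. -/
open MeasureTheory Metric Set Filter

/-- If `E₁, E₂ ⊆ Ω` are measurable, `c₁, c₂ ∈ {0,1}` are not both `1`,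
`χ_{E₁}` has trace `c₁` at `x` and `χ_{E₂}` has trace `c₂` at `x`, then `χ_{E₁ \ E₂}`
has trace `c₁` at `x`. -/
theorem stmt_11 {X : Type*} [MetricSpace X] [MeasurableSpace X] [BorelSpace X]
    (μ : Measure X) (Ω : Set X) (hΩ : MeasurableSet Ω) (x : X)
    (hpos : ∃ r₀ > 0, ∀ r : ℝ, 0 < r → r < r₀ → 0 < μ (ball x r ∩ Ω))
    (E₁ E₂ : Set X) (hE₁m : MeasurableSet E₁) (hE₂m : MeasurableSet E₂)
    (hE₁Ω : E₁ ⊆ Ω) (hE₂Ω : E₂ ⊆ Ω)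
    (c₁ c₂ : ℝ) (hc₁ : c₁ = 0 ∨ c₁ = 1) (hc₂ : c₂ = 0 ∨ c₂ = 1)
    (hc : ¬(c₁ = 1 ∧ c₂ = 1))
    (h₁ : HasTraceAt μ Ω (indicator E₁ 1) x c₁)
    (h₂ : HasTraceAt μ Ω (indicator E₂ 1) x c₂) :
    HasTraceAt μ Ω (indicator (E₁ \ E₂) 1) x c₁ := by
  unfold HasTraceAt at *
  have hs := h₁.add h₂
  rw [add_zero] at hs
  refine squeeze_zero (fun r => ?_) (fun r => ?_) hs
  · exact div_nonneg (integral_nonneg fun y => abs_nonneg _) ENNReal.toReal_nonneg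
  · by_cases hfin : μ (ball x r ∩ Ω) = ⊤
    · simp [hfin]
    · haveI : IsFiniteMeasure (μ.restrict (ball x r ∩ Ω)) :=
        ⟨by simpa using lt_top_iff_ne_top.mpr hfin⟩
      have hint : ∀ (E : Set X) (c : ℝ), MeasurableSet E →
          Integrable (fun y => |indicator E (1 : X → ℝ) y - c|) (μ.restrict (ball x r ∩ Ω)) := by
        intro E c hE
        have h1 : Integrable (indicator E (1 : X → ℝ)) (μ.restrict (ball x r ∩ Ω)) :=
          (integrable_const (1 : ℝ)).indicator hE
        exact (h1.sub (integrable_const c)).abs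
      rw [← add_div, ← integral_add (hint E₁ c₁ hE₁m) (hint E₂ c₂ hE₂m)]
      refine div_le_div_of_nonneg_right ?_ ENNReal.toReal_nonneg
      refine integral_mono (hint _ _ (hE₁m.diff hE₂m))
        ((hint E₁ c₁ hE₁m).add (hint E₂ c₂ hE₂m)) (fun y => ?_)
      rcases hc₁ with rfl | rfl <;> rcases hc₂ with rfl | rfl <;>
        by_cases hy1 : y ∈ E₁ <;> by_cases hy2 : y ∈ E₂ <;>
        simp_all [indicator]
end

section
/- Let (X,d) be a metric space equipped with a Borel measure μ, let Ω ⊆ X be a μ-measurable set, and let x ∈ X be a point such that μ(B(x,r) ∩ Ω) > 0 for all sufficiently small r > 0. Let u : Ω → ℝ and, for each k ∈ ℕ, let u_k, v_k : Ω → ℝ be μ-integrable on B(x,r) ∩ Ω for small r > 0, with u_k ≤ u ≤ v_k μ-a.e. on Ω for every k. Suppose that for every k, u_k has trace a_k at x and v_k has trace b_k at x, and that a_k → a and b_k → a as k → ∞. Then u has trace a at x. -/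
open MeasureTheory Metric Set Filter

/-- If `u_k ≤ u ≤ v_k` μ-a.e. on `Ω` for each `k`, `u_k` has trace `a_k`
at `x`, `v_k` has trace `b_k` at `x`, and `a_k → a`, `b_k → a`, then `u` has trace `a`
at `x`. -/
theorem stmt_12 {X : Type*} [MetricSpace X] [MeasurableSpace X] [BorelSpace X]
    (μ : Measure X) (Ω : Set X) (hΩ : MeasurableSet Ω) (x : X)
    (hpos : ∃ r₀ > 0, ∀ r : ℝ, 0 < r → r < r₀ → 0 < μ (ball x r ∩ Ω))
    (u : X → ℝ) (uk vk : ℕ → X → ℝ) (a : ℝ) (ak bk : ℕ → ℝ)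
    (hki : ∀ k : ℕ, ∃ r₀ > 0, ∀ r : ℝ, 0 < r → r < r₀ →
      IntegrableOn (uk k) (ball x r ∩ Ω) μ ∧ IntegrableOn (vk k) (ball x r ∩ Ω) μ)
    (hui : ∃ r₀ > 0, ∀ r : ℝ, 0 < r → r < r₀ → IntegrableOn u (ball x r ∩ Ω) μ)
    (hsq : ∀ k : ℕ, ∀ᵐ y ∂μ, y ∈ Ω → uk k y ≤ u y ∧ u y ≤ vk k y)
    (htru : ∀ k : ℕ, HasTraceAt μ Ω (uk k) x (ak k))
    (htrv : ∀ k : ℕ, HasTraceAt μ Ω (vk k) x (bk k))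
    (hak : Tendsto ak atTop (nhds a)) (hbk : Tendsto bk atTop (nhds a)) :
    HasTraceAt μ Ω u x a := by
  unfold HasTraceAt at *
  rw [Metric.tendsto_nhds]
  intro ε hε
  obtain ⟨k, hk1, hk2⟩ := ((Metric.tendsto_nhds.1 hak (ε / 4) (by positivity)).and
    (Metric.tendsto_nhds.1 hbk (ε / 4) (by positivity))).exists
  rw [Real.dist_eq] at hk1 hk2
  obtain ⟨r₁, hr₁, h1⟩ := hki k
  obtain ⟨r₂, hr₂, h2⟩ := hui
  filter_upwards [Metric.tendsto_nhds.1 (htru k) (ε / 4) (by positivity),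
    Metric.tendsto_nhds.1 (htrv k) (ε / 4) (by positivity),
    Ioo_mem_nhdsGT hr₁, Ioo_mem_nhdsGT hr₂] with r hu hv hra hrb
  obtain ⟨iu, iv⟩ := h1 r hra.1 hra.2
  have i0 := h2 r hrb.1 hrb.2
  rw [Real.dist_eq, sub_zero] at hu hv ⊢
  have hu := lt_of_abs_lt hu
  have hv := lt_of_abs_lt hv
  rw [abs_of_nonneg (div_nonneg (integral_nonneg fun y => abs_nonneg _) ENNReal.toReal_nonneg)]
  rcases (ENNReal.toReal_nonneg (a := μ (ball x r ∩ Ω))).eq_or_lt with h0 | h0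
  · rw [← h0, div_zero]; exact hε
  have hfin : μ (ball x r ∩ Ω) ≠ ⊤ := (ENNReal.toReal_pos_iff.1 h0).2.ne
  have ic : ∀ c : ℝ, IntegrableOn (fun _ => c) (ball x r ∩ Ω) μ := fun c =>
    integrableOn_const hfin
  have ju : IntegrableOn (fun y => |uk k y - ak k|) (ball x r ∩ Ω) μ := (iu.sub (ic _)).abs
  have jv : IntegrableOn (fun y => |vk k y - bk k|) (ball x r ∩ Ω) μ := (iv.sub (ic _)).abs
  have j0 : IntegrableOn (fun y => |u y - a|) (ball x r ∩ Ω) μ := (i0.sub (ic _)).abs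
  have juv : IntegrableOn (fun y => |uk k y - ak k| + |vk k y - bk k|) (ball x r ∩ Ω) μ :=
    ju.add jv
  have key : ∫ y in ball x r ∩ Ω, |u y - a| ∂μ ≤
      ∫ y in ball x r ∩ Ω, ((|uk k y - ak k| + |vk k y - bk k|) + ε / 2) ∂μ := by
    refine setIntegral_mono_on_ae j0 (juv.add (ic _)) (measurableSet_ball.inter hΩ) ?_
    filter_upwards [hsq k] with y hy hyB
    obtain ⟨p, q⟩ := hy hyB.2
    have e1 := abs_lt.1 hk1
    have e2 := abs_lt.1 hk2
    have e3 := neg_abs_le (uk k y - ak k)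
    have e4 := le_abs_self (vk k y - bk k)
    have e5 := abs_nonneg (uk k y - ak k)
    have e6 := abs_nonneg (vk k y - bk k)
    rw [abs_le]
    constructor <;> linarith [e1.1, e1.2, e2.1, e2.2]
  rw [integral_add juv (ic _), integral_add ju jv, setIntegral_const, smul_eq_mul,
    measureReal_def] at key
  rw [div_lt_iff₀ h0] at hu hv ⊢
  linarith
end

section
/- Let (X,d) be a metric space, A ⊆ X, and ν a Borel measure on X. Let f : A → ℝ be ν-integrable on A. Suppose that for each ε > 0 we are given a finite set of points {x_i}_{i∈I_ε} ⊆ A with 0 < ν(B(x_i,ε) ∩ A) < ∞ for each i, together with functions φ_i^ε : X → [0,1] such that φ_i^ε vanishes outside B(x_i, 2ε) and Σ_{i∈I_ε} φ_i^ε(y) = 1 for every y ∈ A. Define f_ε : X → ℝ by f_ε(y) = Σ_{i∈I_ε} f_{B_{i,ε}} φ_i^ε(y), where f_{B_{i,ε}} = (1/ν(B(x_i,ε)∩A)) ∫_{B(x_i,ε)∩A} f dν. If f is continuous at a point x ∈ A, then for every η > 0 there exists δ > 0 such that for all ε with 0 < ε < δ and all y ∈ B(x,δ) ∩ A, one has |f_ε(y)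 − f(x)| < η. -/
open MeasureTheory Metric Set Filter

/-- Continuity of discrete convolutions at points of continuity of the
data.  If `f` is continuous at `x ∈ A`, then for every `η > 0` there is `δ > 0` such
that for all `0 < ε < δ` and all `y ∈ B(x,δ) ∩ A`, the discrete convolution
`f_ε(y) = Σ_i f_{B_{i,ε}} φ_i^ε(y)` satisfies `|f_ε(y) − f(x)| < η`. -/
theorem stmt_13 {X : Type*} {ι : Type*} [MetricSpace X] [MeasurableSpace X] [BorelSpace X]
    (ν : Measure X) (A : Set X) (f : X → ℝ) (hf : IntegrableOn f A ν)
    (Iset : ℝ → Finset ι) (pt : ℝ → ι → X) (φ : ℝ → ι → X → ℝ)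
    (hpt : ∀ ε > (0 : ℝ), ∀ i ∈ Iset ε, pt ε i ∈ A)
    (hν : ∀ ε > (0 : ℝ), ∀ i ∈ Iset ε,
      0 < ν (ball (pt ε i) ε ∩ A) ∧ ν (ball (pt ε i) ε ∩ A) < ⊤)
    (hφ01 : ∀ ε > (0 : ℝ), ∀ i ∈ Iset ε, ∀ y : X, φ ε i y ∈ Icc (0 : ℝ) 1)
    (hφsupp : ∀ ε > (0 : ℝ), ∀ i ∈ Iset ε, ∀ y : X,
      y ∉ ball (pt ε i) (2 * ε) → φ ε i y = 0)
    (hφsum : ∀ ε > (0 : ℝ), ∀ y ∈ A, ∑ i ∈ Iset ε, φ ε i y = 1)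
    (x : X) (hx : x ∈ A) (hcont : ContinuousWithinAt f A x) :
    ∀ η > (0 : ℝ), ∃ δ > (0 : ℝ), ∀ ε : ℝ, 0 < ε → ε < δ →
      ∀ y ∈ ball x δ ∩ A,
        |(∑ i ∈ Iset ε,
            ((∫ z in ball (pt ε i) ε ∩ A, f z ∂ν) / (ν (ball (pt ε i) ε ∩ A)).toReal) *
              φ ε i y) - f x| < η := by
  intro η hη
  obtain ⟨r, hr, hfr⟩ := Metric.continuousWithinAt_iff.1 hcont (η / 2) (by positivity)
  refine ⟨r / 4, by positivity, ?_⟩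
  intro ε hε hεr y hy
  obtain ⟨hyx, hyA⟩ := hy
  rw [mem_ball] at hyx
  have hterm : ∀ i ∈ Iset ε,
      |((∫ z in ball (pt ε i) ε ∩ A, f z ∂ν) / (ν (ball (pt ε i) ε ∩ A)).toReal - f x) *
        φ ε i y| ≤ η / 2 * φ ε i y := by
    intro i hi
    have h0 := (hφ01 ε hε i hi y).1
    by_cases hyb : y ∈ ball (pt ε i) (2 * ε)
    · rw [abs_mul, abs_of_nonneg h0]
      refine mul_le_mul_of_nonneg_right ?_ h0
      obtain ⟨hpos, hfin⟩ := hν ε hε i hi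
      have hm : 0 < (ν (ball (pt ε i) ε ∩ A)).toReal := ENNReal.toReal_pos hpos.ne' hfin.ne
      have hfi : IntegrableOn f (ball (pt ε i) ε ∩ A) ν := hf.mono_set inter_subset_right
      have hci : IntegrableOn (fun _ : X => f x) (ball (pt ε i) ε ∩ A) ν :=
        integrableOn_const hfin.ne
      have hb : ‖∫ z in ball (pt ε i) ε ∩ A, (f z - f x) ∂ν‖ ≤
          η / 2 * ν.real (ball (pt ε i) ε ∩ A) := by
        refine norm_setIntegral_le_of_norm_le_const hfin ?_
        rintro z ⟨hz, hzA⟩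
        rw [← dist_eq_norm]
        refine (hfr hzA ?_).le
        rw [mem_ball] at hz hyb
        have h1 := dist_triangle z (pt ε i) x
        have h2 := dist_triangle_left (pt ε i) x y
        linarith
      rw [integral_sub hfi hci, setIntegral_const, smul_eq_mul, Real.norm_eq_abs,
        Measure.real] at hb
      rw [div_sub' hm.ne', abs_div, abs_of_pos hm, div_le_iff₀ hm]
      exact hb
    · simp [hφsupp ε hε i hi y hyb]
  have hsum := hφsum ε hε y hyA
  have heq : (∑ i ∈ Iset ε,
      ((∫ z in ball (pt ε i) ε ∩ A, f z ∂ν) / (ν (ball (pt ε i) ε ∩ A)).toReal) * φ ε i y) - f x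
      = ∑ i ∈ Iset ε,
      ((∫ z in ball (pt ε i) ε ∩ A, f z ∂ν) / (ν (ball (pt ε i) ε ∩ A)).toReal - f x) *
        φ ε i y := by
    simp only [sub_mul, Finset.sum_sub_distrib, ← Finset.mul_sum, hsum, mul_one]
  rw [heq]
  calc _ ≤ _ := Finset.abs_sum_le_sum_abs _ _
    _ ≤ ∑ i ∈ Iset ε, η / 2 * φ ε i y := Finset.sum_le_sum hterm
    _ = η / 2 := by rw [← Finset.mul_sum, hsum, mul_one]
    _ < η := by linarith
end

section
/- Let (X,d) be a metric space, A ⊆ X, and ν a Borel measure on X. Let f : A → ℝ be ν-integrable on A. Let ε > 0, let {x_i}_{i∈I} ⊆ A be a finite set of points with 0 < ν(B(x_i,ε) ∩ A) < ∞ for each i, and let φ_i : X → [0,1] vanish outside B(x_i, 2ε). Suppose there are constants D ≥ 1 and N ≥ 1 such that (i) ν(B(x_i,2ε) ∩ A) ≤ D · ν(B(x_i,ε) ∩ A) for every i ∈ I, and (ii) Σ_{i∈I} χ_{B(x_i,ε)}(y) ≤ N for every y ∈ A. Define f_ε(y) = Σ_{i∈I} f_{B_i} φ_i(y), where f_{B_i}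 = (1/ν(B(x_i,ε)∩A)) ∫_{B(x_i,ε)∩A} f dν. Then ∫_A |f_ε| dν ≤ D·N ∫_A |f| dν. -/
open MeasureTheory Metric Set Classical

/-- The `L¹` bound for discrete convolutions.  Under a doubling
condition (i) and a bounded overlap condition (ii), the discrete convolution
`f_ε(y) = Σ_i f_{B_i} φ_i(y)` satisfies `∫_A |f_ε| dν ≤ D·N·∫_A |f| dν`. -/
theorem stmt_14 {X : Type*} {ι : Type*} [MetricSpace X] [MeasurableSpace X] [BorelSpace X]
    (ν : Measure X) (A : Set X) (f : X → ℝ) (hf : IntegrableOn f A ν)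
    (ε : ℝ) (hε : 0 < ε) (I : Finset ι) (pt : ι → X) (φ : ι → X → ℝ)
    (hpt : ∀ i ∈ I, pt i ∈ A)
    (hν : ∀ i ∈ I, 0 < ν (ball (pt i) ε ∩ A) ∧ ν (ball (pt i) ε ∩ A) < ⊤)
    (hφ01 : ∀ i ∈ I, ∀ y : X, φ i y ∈ Icc (0 : ℝ) 1)
    (hφsupp : ∀ i ∈ I, ∀ y : X, y ∉ ball (pt i) (2 * ε) → φ i y = 0)
    (D N : ℝ) (hD : 1 ≤ D) (hN : 1 ≤ N)
    (hdoub : ∀ i ∈ I,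
      ν (ball (pt i) (2 * ε) ∩ A) ≤ ENNReal.ofReal D * ν (ball (pt i) ε ∩ A))
    (hover : ∀ y ∈ A, (∑ i ∈ I, if y ∈ ball (pt i) ε then (1 : ℝ) else 0) ≤ N) :
    ∫ y in A,
        |∑ i ∈ I,
          ((∫ z in ball (pt i) ε ∩ A, f z ∂ν) / (ν (ball (pt i) ε ∩ A)).toReal) * φ i y|
          ∂ν
      ≤ D * N * ∫ y in A, |f y| ∂ν := by
  set μ := ν.restrict A with hμ
  have hb : ∀ (x : X) (r : ℝ), μ (ball x r) = ν (ball x r ∩ A) := fun x r =>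
    Measure.restrict_apply measurableSet_ball
  have hr : ∀ (x : X) (r : ℝ), ν.restrict (ball x r ∩ A) = μ.restrict (ball x r) := fun x r =>
    (Measure.restrict_restrict measurableSet_ball).symm
  simp only [hr, ← hb] at *
  have hf' : Integrable f μ := hf
  have hover' : ∀ᵐ y ∂μ, (∑ i ∈ I, if y ∈ ball (pt i) ε then (1 : ℝ) else 0) ≤ N := by
    rw [hμ, ae_restrict_iff]
    · exact Filter.Eventually.of_forall hover
    · refine measurableSet_le ?_ measurable_const
      refine Finset.measurable_sum _ fun i _ => ?_
      exact Measurable.ite measurableSet_ball measurable_const measurable_const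
  have hfin : ∀ i ∈ I, μ (ball (pt i) (2 * ε)) < ⊤ := fun i hi =>
    (hdoub i hi).trans_lt (ENNReal.mul_lt_top ENNReal.ofReal_lt_top (hν i hi).2)
  have hdr : ∀ i ∈ I, μ.real (ball (pt i) (2 * ε)) ≤ D * μ.real (ball (pt i) ε) := by
    intro i hi
    have h := ENNReal.toReal_mono
      (ENNReal.mul_lt_top ENNReal.ofReal_lt_top (hν i hi).2).ne (hdoub i hi)
    rwa [ENNReal.toReal_mul, ENNReal.toReal_ofReal (by linarith)] at h
  set c : ι → ℝ := fun i => (∫ z in ball (pt i) ε, f z ∂μ) / (μ (ball (pt i) ε)).toReal with hc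
  have hint : ∀ i ∈ I, Integrable
      (fun y => |c i| * (ball (pt i) (2 * ε)).indicator (fun _ => (1 : ℝ)) y) μ := fun i hi =>
    ((integrable_indicator_iff measurableSet_ball).2
      (integrableOn_const (hfin i hi).ne)).const_mul _
  have hindf : ∀ i ∈ I, Integrable ((ball (pt i) ε).indicator (fun y => |f y|)) μ :=
    fun i _ => hf'.abs.indicator measurableSet_ball
  calc ∫ y, |∑ i ∈ I, c i * φ i y| ∂μ
      ≤ ∫ y, ∑ i ∈ I, |c i| * (ball (pt i) (2 * ε)).indicator (fun _ => (1 : ℝ)) y ∂μ := by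
        refine integral_mono_of_nonneg (Filter.Eventually.of_forall fun y => abs_nonneg _)
          (integrable_finsetSum _ hint) (Filter.Eventually.of_forall fun y => ?_)
        refine (Finset.abs_sum_le_sum_abs _ _).trans (Finset.sum_le_sum fun i hi => ?_)
        rw [abs_mul]
        refine mul_le_mul_of_nonneg_left ?_ (abs_nonneg _)
        by_cases hy : y ∈ ball (pt i) (2 * ε)
        · rw [indicator_of_mem hy, abs_of_nonneg (hφ01 i hi y).1]
          exact (hφ01 i hi y).2
        · rw [indicator_of_notMem hy, hφsupp i hi y hy, abs_zero]
    _ = ∑ i ∈ I, |c i| * μ.real (ball (pt i) (2 * ε)) := by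
        rw [integral_finsetSum _ hint]
        refine Finset.sum_congr rfl fun i _ => ?_
        rw [integral_const_mul, integral_indicator measurableSet_ball]
        simp
    _ ≤ ∑ i ∈ I, D * ∫ y, (ball (pt i) ε).indicator (fun y => |f y|) y ∂μ := by
        refine Finset.sum_le_sum fun i hi => ?_
        have hpos : 0 < μ.real (ball (pt i) ε) :=
          ENNReal.toReal_pos (hν i hi).1.ne' (hν i hi).2.ne
        have hci : |c i| * μ.real (ball (pt i) ε) = |∫ z in ball (pt i) ε, f z ∂μ| := by
          change |_ / μ.real (ball (pt i) ε)| * _ = _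
          rw [abs_div, abs_of_pos hpos, div_mul_cancel₀ _ hpos.ne']
        rw [integral_indicator measurableSet_ball]
        calc |c i| * μ.real (ball (pt i) (2 * ε))
            ≤ |c i| * (D * μ.real (ball (pt i) ε)) :=
              mul_le_mul_of_nonneg_left (hdr i hi) (abs_nonneg _)
          _ = D * |∫ z in ball (pt i) ε, f z ∂μ| := by rw [← hci]; ring
          _ ≤ _ := mul_le_mul_of_nonneg_left abs_integral_le_integral_abs (by linarith)
    _ = D * ∫ y, ∑ i ∈ I, (ball (pt i) ε).indicator (fun y => |f y|) y ∂μ := by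
        rw [integral_finsetSum _ hindf, Finset.mul_sum]
    _ ≤ D * ∫ y, N * |f y| ∂μ := by
        refine mul_le_mul_of_nonneg_left ?_ (by linarith)
        refine integral_mono_ae (integrable_finsetSum _ hindf) (hf'.abs.const_mul _) ?_
        filter_upwards [hover'] with y hy
        refine le_trans (le_of_eq ?_) (mul_le_mul_of_nonneg_right hy (abs_nonneg (f y)))
        rw [Finset.sum_mul]
        refine Finset.sum_congr rfl fun i _ => ?_
        by_cases h : y ∈ ball (pt i) ε
        · rw [indicator_of_mem h, if_pos h, one_mul]
        · rw [indicator_of_notMem h, if_neg h, zero_mul]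
    _ = D * N * ∫ y, |f y| ∂μ := by rw [integral_const_mul, mul_assoc]
end
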